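/- Every matroid p-parity system (N, I) is a p-bilevel-swappable system. -/

import Mathlib

namespace Matroid

variable {α β : Type*}

/-- The rank of a finite set in a matroid, as a natural number. -/
noncomputable def finsetRank (M : Matroid β) (X : Finset β) : ℕ := (M.eRk ↑X).toNat

lemma coe_finsetRank (M : Matroid β) (X : Finset β) : (M.finsetRank X : ℕ∞) = M.eRk ↑X := by
  refine ENat.natCast_toNat (ne_top_of_le_ne_top ?_ (M.eRk_le_encard _))
  simp

lemma finsetRank_le_card (M : Matroid β) (X : Finset β) : M.finsetRank X ≤ X.card := by
  have h := M.eRk_le_encard (X : Set β)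
  rw [← coe_finsetRank, Set.encard_coe_eq_coe_finsetCard] at h
  exact_mod_cast h

lemma finsetRank_mono (M : Matroid β) {X Y : Finset β} (h : X ⊆ Y) :
    M.finsetRank X ≤ M.finsetRank Y := by
  have h := M.eRk_mono (Finset.coe_subset.mpr h)
  rw [← coe_finsetRank, ← coe_finsetRank] at h
  exact_mod_cast h

lemma indep_iff_finsetRank_eq_card (M : Matroid β) (X : Finset β) :
    M.Indep ↑X ↔ M.finsetRank X = X.card := by
  rw [indep_iff_eRk_eq_encard_of_finite X.finite_toSet, ← coe_finsetRank,
    Set.encard_coe_eq_coe_finsetCard]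
  norm_cast

variable [DecidableEq β]

lemma finsetRank_submod (M : Matroid β) (X Y : Finset β) :
    M.finsetRank (X ∩ Y) + M.finsetRank (X ∪ Y) ≤ M.finsetRank X + M.finsetRank Y := by
  have h := M.eRk_inter_add_eRk_union_le (X : Set β) (Y : Set β)
  rw [← Finset.coe_inter, ← Finset.coe_union] at h
  simp only [← coe_finsetRank] at h
  exact_mod_cast h

lemma finsetRank_add_le_of_subset (M : Matroid β) {X Y U W : Finset β}
    (hU : U ⊆ X ∩ Y) (hW : W ⊆ X ∪ Y) :
    M.finsetRank U + M.finsetRank W ≤ M.finsetRank X + M.finsetRank Y :=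
  (add_le_add (M.finsetRank_mono hU) (M.finsetRank_mono hW)).trans (M.finsetRank_submod X Y)

/-- If the ranks of `X ∪ D₁` and `X ∪ D₂` are jointly large enough for all `X ⊆ A`, then `A` can
be split into two parts, the first extending `D₁` and the second extending `D₂` to independent
sets. This is the two-matroid covering theorem for the contractions of `M` by `D₁` and `D₂`. -/
lemma exists_split_of_card_le_finsetRank (M : Matroid β) (A D₁ D₂ : Finset β)
    (h : ∀ X ⊆ A, X.card + D₁.card + D₂.card ≤
      M.finsetRank (X ∪ D₁) + M.finsetRank (X ∪ D₂)) :
    ∃ A₁ A₂ : Finset β, A₁ ∪ A₂ = A ∧ Disjoint A₁ A₂ ∧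
      M.Indep ↑(A₁ ∪ D₁) ∧ M.Indep ↑(A₂ ∪ D₂) := by
  induction A using Finset.induction_on generalizing D₁ D₂ with
  | empty =>
    have h0 := h ∅ subset_rfl
    have h1 := M.finsetRank_le_card D₁
    have h2 := M.finsetRank_le_card D₂
    simp only [Finset.empty_union, Finset.card_empty] at h0
    refine ⟨∅, ∅, by simp, by simp, ?_, ?_⟩ <;>
      rw [indep_iff_finsetRank_eq_card, Finset.empty_union] <;> omega
  | insert e A he ih =>
    by_cases h1 : ∀ X ⊆ A, X.card + (insert e D₁).card + D₂.card ≤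
        M.finsetRank (X ∪ insert e D₁) + M.finsetRank (X ∪ D₂)
    · obtain ⟨A₁, A₂, hA, hd, hi₁, hi₂⟩ := ih _ _ h1
      refine ⟨insert e A₁, A₂, by rw [← hA, Finset.insert_union], ?_, ?_, hi₂⟩
      · rw [Finset.disjoint_insert_left]
        exact ⟨fun h => he (hA ▸ Finset.mem_union_right _ h), hd⟩
      · rwa [Finset.insert_union, ← Finset.union_insert]
    by_cases h2 : ∀ X ⊆ A, X.card + D₁.card + (insert e D₂).card ≤
        M.finsetRank (X ∪ D₁) + M.finsetRank (X ∪ insert e D₂)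
    · obtain ⟨A₁, A₂, hA, hd, hi₁, hi₂⟩ := ih _ _ h2
      refine ⟨A₁, insert e A₂, by rw [← hA, Finset.union_insert], ?_, hi₁, ?_⟩
      · rw [Finset.disjoint_insert_right]
        exact ⟨fun h => he (hA ▸ Finset.mem_union_left _ h), hd⟩
      · rwa [Finset.insert_union, ← Finset.union_insert]
    exfalso
    push Not at h1 h2
    obtain ⟨X, hX, hX'⟩ := h1
    obtain ⟨Y, hY, hY'⟩ := h2
    have c1 := Finset.card_insert_le e D₁
    have c2 := Finset.card_insert_le e D₂
    have s1 := M.finsetRank_add_le_of_subset (X := X ∪ insert e D₁) (Y := Y ∪ D₁)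
      (U := X ∩ Y ∪ D₁) (W := insert e (X ∪ Y) ∪ D₁) (by grind) (by grind)
    have s2 := M.finsetRank_add_le_of_subset (X := X ∪ D₂) (Y := Y ∪ insert e D₂)
      (U := X ∩ Y ∪ D₂) (W := insert e (X ∪ Y) ∪ D₂) (by grind) (by grind)
    have k1 := h (X ∩ Y) (by grind)
    have k2 := h (insert e (X ∪ Y)) (by grind)
    rw [Finset.card_insert_of_notMem (by grind)] at k2
    have := Finset.card_union_add_card_inter X Y
    omega

/-- Multiple exchange: if `A` and `B₁ ∪ B₂` are independent modulo `C`, then `A` splits into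
`A₁` and `A₂` with `A₁ ∪ B₁` and `A₂ ∪ B₂` independent modulo `C`. -/
lemma Indep.exists_split {M : Matroid β} {A B₁ B₂ C : Finset β} (hAC : Disjoint A C)
    (hB : Disjoint B₁ B₂) (hA : M.Indep ↑(A ∪ C)) (hBC : M.Indep ↑(B₁ ∪ B₂ ∪ C)) :
    ∃ A₁ A₂ : Finset β, A₁ ∪ A₂ = A ∧ Disjoint A₁ A₂ ∧
      M.Indep ↑(A₁ ∪ (B₁ ∪ C)) ∧ M.Indep ↑(A₂ ∪ (B₂ ∪ C)) := by
  refine M.exists_split_of_card_le_finsetRank _ _ _ fun X hX => ?_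
  have hXC : M.Indep ↑(X ∪ C) :=
    hA.subset (Finset.coe_subset.mpr (Finset.union_subset_union_left hX))
  rw [indep_iff_finsetRank_eq_card] at hXC hBC
  rw [Finset.card_union_of_disjoint (Finset.disjoint_of_subset_left hX hAC)] at hXC
  have s := M.finsetRank_add_le_of_subset (X := X ∪ (B₁ ∪ C)) (Y := X ∪ (B₂ ∪ C))
    (U := X ∪ C) (W := B₁ ∪ B₂ ∪ C) (by grind) (by grind)
  have c := Finset.card_union_add_card_inter (B₁ ∪ C) (B₂ ∪ C)
  rw [← Finset.inter_union_distrib_right, Finset.disjoint_iff_inter_eq_empty.mp hB,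
    Finset.empty_union, ← Finset.union_union_distrib_right] at c
  omega

/-- Partition exchange: if `A` and `⋃ t ∈ T, v t` are independent modulo `C`, then there are
disjoint subsets `P t` of `A` such that each `(A \ P t) ∪ v t` is independent modulo `C`. -/
lemma Indep.exists_disjoint_exchange [DecidableEq α] {M : Matroid β} {v : α → Finset β}
    (hv : ∀ u u' : α, u ≠ u' → Disjoint (v u) (v u')) (T : Finset α) {A C : Finset β}
    (hAC : Disjoint A C) (hA : M.Indep ↑(A ∪ C)) (hT : M.Indep ↑(T.biUnion v ∪ C)) :
    ∃ P : α → Finset β, (∀ t ∈ T, P t ⊆ A) ∧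
      (∀ t ∈ T, ∀ t' ∈ T, t ≠ t' → Disjoint (P t) (P t')) ∧
      ∀ t ∈ T, M.Indep ↑(A \ P t ∪ v t ∪ C) := by
  induction T using Finset.induction_on generalizing A C with
  | empty => exact ⟨fun _ => ∅, by simp⟩
  | insert u T hu ih =>
    rw [Finset.biUnion_insert] at hT
    have hd : Disjoint (v u) (T.biUnion v) := by
      rw [Finset.disjoint_biUnion_right]
      exact fun t ht => hv _ _ (by rintro rfl; exact hu ht)
    obtain ⟨A₁, A₂, rfl, hA₁₂, hi₁, hi₂⟩ := Indep.exists_split hAC hd hA hT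
    obtain ⟨P, hP, hPd, hPi⟩ := ih (A := A₁) (C := A₂ ∪ C)
      (Finset.disjoint_union_right.mpr ⟨hA₁₂, (Finset.disjoint_union_left.mp hAC).1⟩)
      (by rwa [← Finset.union_assoc]) (by rwa [Finset.union_left_comm])
    have hne : ∀ t ∈ T, t ≠ u := by rintro t ht rfl; exact hu ht
    have hPu : ∀ t ∈ T, Disjoint (P t) A₂ := fun t ht =>
      Finset.disjoint_of_subset_left (hP t ht) hA₁₂
    refine ⟨Function.update P u A₂, ?_, ?_, ?_⟩
    · intro t ht
      rcases Finset.mem_insert.mp ht with rfl | ht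
      · simp
      · rw [Function.update_of_ne (hne t ht)]
        exact (hP t ht).trans Finset.subset_union_left
    · intro t ht t' ht' htt'
      rw [Finset.mem_insert] at ht ht'
      rcases ht with rfl | ht <;> rcases ht' with rfl | ht'
      · exact absurd rfl htt'
      · rw [Function.update_self, Function.update_of_ne (hne t' ht')]
        exact (hPu t' ht').symm
      · rw [Function.update_self, Function.update_of_ne (hne t ht)]
        exact hPu t ht
      · rw [Function.update_of_ne (hne t ht), Function.update_of_ne (hne t' ht')]
        exact hPd t ht t' ht' htt'
    · intro t ht
      rcases Finset.mem_insert.mp ht with rfl | ht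
      · rw [Function.update_self]
        exact hi₁.subset (Finset.coe_subset.mpr (by grind))
      · rw [Function.update_of_ne (hne t ht)]
        exact (hPi t ht).subset (Finset.coe_subset.mpr (by grind))

end Matroid

/-- The number of members of a disjoint family that meet `X` is at most the number of elements
of `X` lying in the union of the family. -/
lemma Finset.card_filter_not_disjoint_le {α β : Type*} [DecidableEq β] (T : Finset α)
    (P : α → Finset β) (X : Finset β)
    (hP : ∀ t ∈ T, ∀ t' ∈ T, t ≠ t' → Disjoint (P t) (P t')) :
    (T.filter (fun t => ¬ Disjoint X (P t))).card ≤ (X ∩ T.biUnion P).card := by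
  have hmem : ∀ t ∈ T.filter (fun t => ¬ Disjoint X (P t)), (X ∩ P t).Nonempty := fun t ht =>
    Finset.not_disjoint_iff_nonempty_inter.mp (Finset.mem_filter.mp ht).2
  refine (Finset.card_le_card_biUnion (f := fun t => X ∩ P t) ?_ hmem).trans
    (Finset.card_le_card ?_)
  · intro t ht t' ht' htt'
    exact (hP t (Finset.mem_filter.mp ht).1 t' (Finset.mem_filter.mp ht').1 htt').mono
      Finset.inter_subset_right Finset.inter_subset_right
  · intro x hx
    simp only [Finset.mem_biUnion, Finset.mem_filter, Finset.mem_inter] at hx ⊢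
    obtain ⟨t, ⟨ht, -⟩, hx, hxt⟩ := hx
    exact ⟨hx, t, ht, hxt⟩

/-- Every matroid `p`-parity system `(N, I)` is `p`-bilevel-swappable.
Here `(N, I)` is represented by a matroid `M` on a ground type `β` together with a map
`v` assigning to each element of `N` a subset of `β` of size at most `p`, with the sets
`v u` pairwise disjoint, such that `S ∈ I` iff `⋃_{u ∈ S} v u` is independent in `M`.
The conclusion is `p`-bilevel-swappability: for every two disjoint independent sets `S`
and `T` and every `T_H ⊆ T`, there is a collection `{Y t ⊆ S : t ∈ T \ T_H}` such that
(a) `(S \ Y t) ∪ {t} ∈ I` for every `t ∈ T \ T_H`, (b) every `s ∈ S` appears in at most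
`p` of the sets `Y t`, and (c) `S_L ∪ T_H ∈ I`, where `S_L` is the set of `s ∈ S`
appearing in exactly `p` of the sets `Y t`. -/
theorem statement4 {α β : Type*} [DecidableEq α] [DecidableEq β] (p : ℕ)
    (I : Finset α → Prop)
    (M : Matroid β)
    (v : α → Finset β)
    (hvcard : ∀ u : α, (v u).card ≤ p)
    (hvdisj : ∀ u u' : α, u ≠ u' → Disjoint (v u) (v u'))
    (hI : ∀ S : Finset α, I S ↔ M.Indep ↑(S.biUnion v)) :
    ∀ S T : Finset α, I S → I T → Disjoint S T → ∀ T_H ⊆ T,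
      ∃ Y : α → Finset α,
        (∀ t ∈ T \ T_H, Y t ⊆ S) ∧
        (∀ t ∈ T \ T_H, I ((S \ Y t) ∪ {t})) ∧
        (∀ s ∈ S, ((T \ T_H).filter (fun t => s ∈ Y t)).card ≤ p) ∧
        I ((S.filter (fun s => ((T \ T_H).filter (fun t => s ∈ Y t)).card = p)) ∪ T_H) := by
  intro S T hS hT _ T_H hTH
  rw [hI] at hS hT
  have hsplit : T.biUnion v = T_H.biUnion v ∪ (T \ T_H).biUnion v := by
    rw [← Finset.union_biUnion, Finset.union_sdiff_of_subset hTH]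
  have hd : Disjoint (T_H.biUnion v) ((T \ T_H).biUnion v) := by
    simp only [Finset.disjoint_biUnion_left, Finset.disjoint_biUnion_right]
    intro t ht t' ht'
    exact hvdisj _ _ (by rintro rfl; exact (Finset.mem_sdiff.mp ht).2 ht')
  obtain ⟨A₁, A₂, hA, hA₁₂, hi₁, hi₂⟩ := Matroid.Indep.exists_split (M := M)
    (Finset.disjoint_empty_right (S.biUnion v)) hd
    (by rwa [Finset.union_empty]) (by rwa [Finset.union_empty, ← hsplit])
  rw [Finset.union_empty] at hi₁ hi₂
  obtain ⟨P, hP, hPd, hPi⟩ := Matroid.Indep.exists_disjoint_exchange hvdisj (T \ T_H) hA₁₂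
    (by rwa [hA]) (by rwa [Finset.union_comm])
  have hfilter : ∀ s ∈ S, (T \ T_H).filter
      (fun t => s ∈ S.filter (fun s => ¬ Disjoint (v s) (P t))) =
      (T \ T_H).filter (fun t => ¬ Disjoint (v s) (P t)) := by
    intro s hs
    simp [hs]
  have hcount := fun s => (T \ T_H).card_filter_not_disjoint_le P (v s) hPd
  have hcard : ∀ s, (v s ∩ (T \ T_H).biUnion P).card ≤ (v s).card := fun s =>
    Finset.card_le_card Finset.inter_subset_left
  refine ⟨fun t => S.filter (fun s => ¬ Disjoint (v s) (P t)),
    fun t _ => Finset.filter_subset _ _, ?_, ?_, ?_⟩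
  · intro t ht
    rw [hI]
    refine (hPi t ht).subset (Finset.coe_subset.mpr ?_)
    rw [Finset.union_biUnion, Finset.singleton_biUnion]
    refine Finset.union_subset (fun x hx => ?_) (by grind)
    obtain ⟨s, hs, hx⟩ := Finset.mem_biUnion.mp hx
    have hdis : Disjoint (v s) (P t) := by grind
    have hxP := Finset.disjoint_left.mp hdis hx
    have hxA : x ∈ A₁ ∪ A₂ := hA ▸ Finset.mem_biUnion.mpr ⟨s, (Finset.mem_sdiff.mp hs).1, hx⟩
    grind
  · intro s hs
    rw [hfilter s hs]
    exact (hcount s).trans ((hcard s).trans (hvcard s))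
  · rw [hI]
    refine hi₁.subset (Finset.coe_subset.mpr ?_)
    rw [Finset.union_biUnion]
    refine Finset.union_subset_union_left (Finset.biUnion_subset.mpr fun s hs => ?_)
    obtain ⟨hs, hp⟩ := Finset.mem_filter.mp hs
    rw [hfilter s hs] at hp
    have heq : v s ∩ (T \ T_H).biUnion P = v s :=
      Finset.eq_of_subset_of_card_le Finset.inter_subset_left
        ((hvcard s).trans (hp ▸ hcount s))
    exact (Finset.inter_eq_left.mp heq).trans (Finset.biUnion_subset.mpr hP)
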